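/- For every octonion a, det(ω(a)) = |a|⁸, where ω is the 8×8 left real matrix representation of octonions. -/

import Mathlib

open Matrix Quaternion
open scoped Quaternion

noncomputable section

/-- Left real matrix representation of a quaternion in the basis 1, i, j, k. -/
def phi (a : ℍ[ℝ]) : Matrix (Fin 4) (Fin 4) ℝ :=
  !![a.re, -a.imI, -a.imJ, -a.imK;
     a.imI, a.re, -a.imK, a.imJ;
     a.imJ, a.imK, a.re, -a.imI;
     a.imK, -a.imJ, a.imI, a.re]

/-- K = diag(1, -1, -1, -1). -/
def Kmat : Matrix (Fin 4) (Fin 4) ℝ := Matrix.diagonal ![1, -1, -1, -1]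

/-- Right real matrix representation of a quaternion: τ(a) = K φ(a)ᵀ K. -/
def tau (a : ℍ[ℝ]) : Matrix (Fin 4) (Fin 4) ℝ := Kmat * (phi a)ᵀ * Kmat

/-- Coordinate vector of a quaternion in the basis 1, i, j, k. -/
def qvec (x : ℍ[ℝ]) : Fin 4 → ℝ := ![x.re, x.imI, x.imJ, x.imK]

/-- The octonions, as pairs of quaternions via the Cayley–Dickson process. -/
abbrev Octo := ℍ[ℝ] × ℍ[ℝ]

/-- Octonion multiplication:
  (a' + a''e)(b' + b''e) = (a'b' − b̄''a'') + (b''a' + a'' b̄')e. -/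
def Omul (a b : Octo) : Octo :=
  (a.1 * b.1 - star b.2 * a.2, b.2 * a.1 + a.2 * star b.1)

/-- Octonion conjugation. -/
def Oconj (a : Octo) : Octo := (star a.1, -a.2)

/-- Real part of an octonion. -/
def Ore (a : Octo) : ℝ := a.1.re

/-- The octonion 1. -/
def Oone : Octo := (1, 0)

/-- Squared norm of an octonion. -/
def OnormSq (a : Octo) : ℝ := Quaternion.normSq a.1 + Quaternion.normSq a.2

/-- Norm of an octonion. -/
def Onorm (a : Octo) : ℝ := Real.sqrt (OnormSq a)

/-- Left real matrix representation of an octonion a = a' + a''e: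
  ω(a) = [[φ(a'), −τ(a'')K], [φ(a'')K, τ(a')]]. -/
def omega (a : Octo) : Matrix (Fin 4 ⊕ Fin 4) (Fin 4 ⊕ Fin 4) ℝ :=
  Matrix.fromBlocks (phi a.1) (-(tau a.2 * Kmat)) (phi a.2 * Kmat) (tau a.1)

/-- Coordinate vector of an octonion in the basis 1, e₁, …, e₇. -/
def ovec (x : Octo) : Fin 4 ⊕ Fin 4 → ℝ := Sum.elim (qvec x.1) (qvec x.2)

theorem det_phi (a : ℍ[ℝ]) : (phi a).det = Quaternion.normSq a ^ 2 := by
  simp [phi, Matrix.det_succ_row_zero, Fin.sum_univ_succ, Fin.succAbove, Quaternion.normSq_def']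
  ring

theorem det_Kmat : Kmat.det = -1 := by
  simp [Kmat, Matrix.det_diagonal, Fin.prod_univ_succ]

theorem det_tau (a : ℍ[ℝ]) : (tau a).det = Quaternion.normSq a ^ 2 := by
  simp [tau, det_Kmat, det_phi]

theorem tau_eq (a : ℍ[ℝ]) : tau a =
    !![a.re, -a.imI, -a.imJ, -a.imK;
       a.imI, a.re, a.imK, -a.imJ;
       a.imJ, -a.imK, a.re, a.imI;
       a.imK, a.imJ, -a.imI, a.re] := by
  ext i j
  fin_cases i <;> fin_cases j <;>
    simp [tau, Kmat, phi, Matrix.mul_diagonal, Matrix.diagonal_mul]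

theorem tau_mul_transpose (a : ℍ[ℝ]) :
    tau a * (tau a)ᵀ = Quaternion.normSq a • (1 : Matrix (Fin 4) (Fin 4) ℝ) := by
  rw [tau_eq, Quaternion.normSq_def']
  ext i j
  fin_cases i <;> fin_cases j <;>
    simp [Matrix.mul_apply, Fin.sum_univ_four] <;> ring

theorem tau_Kmat_mul_tau_transpose_mul_phi_Kmat (a b : ℍ[ℝ]) :
    tau b * Kmat * ((tau a)ᵀ * (phi b * Kmat)) = Quaternion.normSq b • phi a := by
  rw [tau_eq, tau_eq, Quaternion.normSq_def']
  ext i j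
  fin_cases i <;> fin_cases j <;>
    simp [Matrix.mul_apply, Fin.sum_univ_four, Kmat, phi, Matrix.vecMul_diagonal] <;> ring

/-- Block elimination in the lower left corner, with the factor `normSq a.1` cleared. -/
theorem omega_mul_eliminate (a : Octo) :
    omega a * Matrix.fromBlocks (Quaternion.normSq a.1 • 1) 0
        (-((tau a.1)ᵀ * (phi a.2 * Kmat))) 1 =
      Matrix.fromBlocks (OnormSq a • phi a.1) (-(tau a.2 * Kmat)) 0 (tau a.1) := by
  rw [omega, Matrix.fromBlocks_multiply]
  congr 1
  · rw [neg_mul_neg, tau_Kmat_mul_tau_transpose_mul_phi_Kmat, OnormSq, add_smul]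
    simp
  · simp
  · rw [mul_neg, ← mul_assoc (tau a.1), tau_mul_transpose]
    simp
  · simp

theorem det_fromBlocks_zero_diagonal {n R : Type*} [Fintype n] [DecidableEq n] [CommRing R]
    (B C : Matrix n n R) :
    (Matrix.fromBlocks 0 B C 0).det = B.det * (-C).det := by
  have h : Matrix.fromBlocks 0 B C 0 * Matrix.fromBlocks 1 0 1 1 * Matrix.fromBlocks 1 (-1) 0 1 =
      Matrix.fromBlocks B 0 C (-C) := by
    simp [Matrix.fromBlocks_multiply]
  simpa using congrArg Matrix.det h

theorem Onorm_pow_eight (a : Octo) : Onorm a ^ 8 = OnormSq a ^ 4 := by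
  have h : 0 ≤ OnormSq a := add_nonneg Quaternion.normSq_nonneg Quaternion.normSq_nonneg
  rw [Onorm, show 8 = 2 * 4 from rfl, pow_mul, Real.sq_sqrt h]

theorem det_omega (a : Octo) : (omega a).det = Onorm a ^ 8 := by
  rw [Onorm_pow_eight]
  by_cases ha : a.1 = 0
  · have hphi : phi 0 = 0 := by
      ext i j
      fin_cases i <;> fin_cases j <;> simp [phi]
    have htau : tau 0 = 0 := by simp [tau, hphi]
    rw [omega, ha, hphi, htau, det_fromBlocks_zero_diagonal]
    simp [Matrix.det_neg, det_tau, det_phi, det_Kmat, OnormSq, ha]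
    ring
  · have hn : Quaternion.normSq a.1 ≠ 0 := Quaternion.normSq_ne_zero.mpr ha
    have h := congrArg Matrix.det (omega_mul_eliminate a)
    simp only [Matrix.det_mul, Matrix.det_fromBlocks_zero₁₂, Matrix.det_fromBlocks_zero₂₁,
      Matrix.det_smul, Matrix.det_one, det_phi, det_tau, Fintype.card_fin, mul_one] at h
    apply mul_right_cancel₀ (pow_ne_zero 4 hn)
    rw [h]
    ring
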